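/- Let ψ ∈ T_n and let A = (A₁,…,Aₙ) be pairwise commuting generators of uniformly bounded C₀-semigroups on a complex Banach space X. Suppose α is an eigenvalue of ψ(A) with eigenvector x, and f ∈ X′ is a joint eigenvector of the adjoint tuple A′ = (A₁′,…,Aₙ′) (i.e. Aⱼ′f = λⱼ f for some λ ∈ ℂⁿ) such that f(x) ≠ 0. Then α = ψ(λ) and α ∈ ψ(σ_R(A)), where σ_R(A) is the joint residual spectrum of A. -/

import Mathlib

open MeasureTheory Filter Topology

noncomputable section

/-- A (one-parameter) `C₀`-semigroup of bounded operators on `X`. -/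
def IsC0Semigroup {X : Type*} [NormedAddCommGroup X] [NormedSpace ℂ X]
    (T : ℝ → X →L[ℂ] X) : Prop :=
  T 0 = 1 ∧ (∀ s t : ℝ, 0 ≤ s → 0 ≤ t → T (s + t) = T s ∘L T t) ∧
    ∀ x : X, Tendsto (fun t => T t x) (𝓝[≥] (0 : ℝ)) (𝓝 x)

/-- `InGenDomain T x y` means `x` belongs to the domain of the infinitesimal generator `A`
of the semigroup `T` and `A x = y`. -/
def InGenDomain {X : Type*} [NormedAddCommGroup X] [NormedSpace ℂ X]
    (T : ℝ → X →L[ℂ] X) (x y : X) : Prop :=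
  Tendsto (fun t : ℝ => t⁻¹ • (T t x - x)) (𝓝[>] (0 : ℝ)) (𝓝 y)

/-- The `n`-parameter semigroup `T(u) = T₁(u₁) ⋯ Tₙ(uₙ)`. -/
def Tprod {X : Type*} [NormedAddCommGroup X] [NormedSpace ℂ X] {n : ℕ}
    (T : Fin n → ℝ → X →L[ℂ] X) (u : Fin n → ℝ) : X →L[ℂ] X :=
  (List.ofFn fun j => T j (u j)).prod

/-- The open negative orthant `(-∞,0)ⁿ`. -/
def negOrthant (n : ℕ) : Set (Fin n → ℝ) := {s | ∀ j, s j < 0}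

/-- The closed nonpositive orthant `(-∞,0]ⁿ`. -/
def nonposOrthant (n : ℕ) : Set (Fin n → ℝ) := {s | ∀ j, s j ≤ 0}

/-- A function of `n` variables is absolutely monotone on `(-∞,0)ⁿ` if it is nonnegative
together with all its iterated partial derivatives there. -/
def AbsMonotoneOn (n : ℕ) (f : (Fin n → ℝ) → ℝ) : Prop :=
  ∀ (k : ℕ) (v : Fin k → Fin n) (s : Fin n → ℝ), s ∈ negOrthant n →
    0 ≤ iteratedFDerivWithin ℝ k f (negOrthant n) s (fun i => Pi.single (v i) 1)

/-- Membership in the class `𝒯ₙ` of (negative) Bernstein functions of `n` variables: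
`ψ` is a nonpositive `C^∞`-function on `(-∞,0)ⁿ` all of whose first-order partial
derivatives are absolutely monotone. -/
def MemTn (n : ℕ) (ψ : (Fin n → ℝ) → ℝ) : Prop :=
  ContDiffOn ℝ (⊤ : ℕ∞) ψ (negOrthant n) ∧ (∀ s ∈ negOrthant n, ψ s ≤ 0) ∧
    ∀ j : Fin n, AbsMonotoneOn n
      (fun s => fderivWithin ℝ ψ (negOrthant n) s (Pi.single j 1))

/-- The Lévy–Khintchine type representation
`ψ(s) = c₀ + c₁·s + ∫ (e^{s·u} - 1) dμ(u)` of a Bernstein function of `n` variables,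
where `c₀ ≤ 0`, `c₁ ∈ ℝ₊ⁿ` and `μ` is a positive measure on `ℝ₊ⁿ \ {0}`. -/
def HasLevyRep (n : ℕ) (ψ : (Fin n → ℝ) → ℝ) (c₀ : ℝ) (c₁ : Fin n → ℝ)
    (μ : Measure (Fin n → ℝ)) : Prop :=
  c₀ ≤ 0 ∧ (∀ j, 0 ≤ c₁ j) ∧ μ {u | ¬ ((∀ j, 0 ≤ u j) ∧ u ≠ 0)} = 0 ∧
    (∀ s ∈ negOrthant n, Integrable (fun u => Real.exp (∑ j, s j * u j) - 1) μ) ∧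
    ∀ s ∈ negOrthant n, ψ s = c₀ + ∑ j, c₁ j * s j +
      ∫ u, (Real.exp (∑ j, s j * u j) - 1) ∂μ

/-- The family of bounded positive measures `ν_t` on `ℝ₊ⁿ` with
`∫ e^{s·u} dν_t(u) = e^{t ψ(s)}` (multidimensional Bernstein–Widder). -/
def IsSubordinator (n : ℕ) (ψ : (Fin n → ℝ) → ℝ) (ν : ℝ → Measure (Fin n → ℝ)) : Prop :=
  ∀ t : ℝ, 0 ≤ t → IsFiniteMeasure (ν t) ∧ (ν t) {u | ¬ ∀ j, 0 ≤ u j} = 0 ∧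
    ∀ s ∈ negOrthant n, ∫ u, Real.exp (∑ j, s j * u j) ∂(ν t) = Real.exp (t * ψ s)

/-- The holomorphic (complex) extension `ψ(λ) = c₀ + c₁·λ + ∫ (e^{λ·u} - 1) dμ(u)`
of a Bernstein function with representation `(c₀, c₁, μ)` to `{Re λ ≤ 0} ⊆ ℂⁿ`. -/
def psiC (n : ℕ) (c₀ : ℝ) (c₁ : Fin n → ℝ) (μ : Measure (Fin n → ℝ))
    (l : Fin n → ℂ) : ℂ :=
  (c₀ : ℂ) + ∑ j, (c₁ j : ℂ) * l j +
    ∫ u, (Complex.exp (∑ j, l j * (u j : ℂ)) - 1) ∂μ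

/-- The joint point spectrum of the tuple of generators of the semigroups `T j`. -/
def JointPointSpectrum {X : Type*} [NormedAddCommGroup X] [NormedSpace ℂ X] {n : ℕ}
    (T : Fin n → ℝ → X →L[ℂ] X) : Set (Fin n → ℂ) :=
  {l | ∃ x : X, x ≠ 0 ∧ ∀ j, InGenDomain (T j) x (l j • x)}

/-- The joint approximate point spectrum of the tuple of generators of the `T j`. -/
def JointApproxSpectrum {X : Type*} [NormedAddCommGroup X] [NormedSpace ℂ X] {n : ℕ}
    (T : Fin n → ℝ → X →L[ℂ] X) : Set (Fin n → ℂ) :=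
  {l | ∃ (x : ℕ → X) (y : Fin n → ℕ → X), (∀ m, ‖x m‖ = 1) ∧
    (∀ j m, InGenDomain (T j) (x m) (y j m)) ∧
    ∀ j, Tendsto (fun m => ‖y j m - l j • x m‖) atTop (𝓝 0)}

/-- The joint residual spectrum of the tuple of generators of the `T j`:
those `λ ∈ ℂⁿ` for which `Σⱼ Im (λⱼ - Aⱼ)` is not dense in `X`. -/
def JointResidualSpectrum {X : Type*} [NormedAddCommGroup X] [NormedSpace ℂ X] {n : ℕ}
    (T : Fin n → ℝ → X →L[ℂ] X) : Set (Fin n → ℂ) :=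
  {l | ¬ Dense (↑(Submodule.span ℂ
      (⋃ j, {z : X | ∃ x y, InGenDomain (T j) x y ∧ z = l j • x - y})) : Set X)}

/-- The point spectrum of a (possibly unbounded) operator given by its graph
relation `R x y ↔ (x ∈ D(B) ∧ B x = y)`. -/
def PointSpec {X : Type*} [NormedAddCommGroup X] [NormedSpace ℂ X]
    (R : X → X → Prop) : Set ℂ :=
  {α | ∃ x : X, x ≠ 0 ∧ R x (α • x)}

/-- The approximate point spectrum of an operator given by its graph relation. -/
def ApproxSpec {X : Type*} [NormedAddCommGroup X] [NormedSpace ℂ X]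
    (R : X → X → Prop) : Set ℂ :=
  {α | ∃ x y : ℕ → X, (∀ m, ‖x m‖ = 1) ∧ (∀ m, R (x m) (y m)) ∧
    Tendsto (fun m => ‖y m - α • x m‖) atTop (𝓝 0)}

/-- The residual spectrum of an operator given by its graph relation:
those `α` for which `Im (α - B)` is not dense. -/
def ResidualSpec {X : Type*} [NormedAddCommGroup X] [NormedSpace ℂ X]
    (R : X → X → Prop) : Set ℂ :=
  {α | ¬ Dense (↑(Submodule.span ℂ {z : X | ∃ x y, R x y ∧ z = α • x - y}) : Set X)}

/-- The resolvent set of a closed operator given by its graph relation: `α` such that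
`α - B : D(B) → X` has a bounded everywhere-defined inverse. -/
def ResolventSet {X : Type*} [NormedAddCommGroup X] [NormedSpace ℂ X]
    (R : X → X → Prop) : Set ℂ :=
  {α | ∃ Rv : X →L[ℂ] X, (∀ z : X, R (Rv z) (α • Rv z - z)) ∧
    ∀ x y : X, R x y → Rv (α • x - y) = x}

/-- The constant `K_M = (M+1)/(1 - e^{-(M+1)/M})` from the moment inequality. -/
def KM (M : ℝ) : ℝ := (M + 1) / (1 - Real.exp (-(M + 1) / M))

/-- The open sector `{z ≠ 0 : |arg z| < θ}` in `ℂ`. -/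
def Sector (θ : ℝ) : Set ℂ := {z | z ≠ 0 ∧ |Complex.arg z| < θ}

/-- A `C₀`-semigroup is holomorphic if it extends to a holomorphic semigroup on some
open sector around the positive half axis, strongly continuous at `0` in the sector. -/
def IsHolomorphicSemigroup {X : Type*} [NormedAddCommGroup X] [NormedSpace ℂ X]
    (T : ℝ → X →L[ℂ] X) : Prop :=
  ∃ (θ : ℝ) (S : ℂ → X →L[ℂ] X), 0 < θ ∧ (∀ t : ℝ, 0 < t → S t = T t) ∧
    (∀ z w : ℂ, z ∈ Sector θ → w ∈ Sector θ → S (z + w) = S z ∘L S w) ∧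
    DifferentiableOn ℂ S (Sector θ) ∧
    ∀ x : X, Tendsto (fun z => S z x) (𝓝[Sector θ] 0) (𝓝 x)

end
lemma aux_cont {X : Type*} [NormedAddCommGroup X] [NormedSpace ℂ X]
    (T : ℝ → X →L[ℂ] X) (M : ℝ) (hT : IsC0Semigroup T) (hM : ∀ t, 0 ≤ t → ‖T t‖ ≤ M) (z : X) :
    Continuous (fun s : ℝ => T (max s 0) z) := by
  obtain ⟨h0, hadd, hlim⟩ := hT
  have hM0 : 0 ≤ M := (norm_nonneg _).trans (hM 0 le_rfl)
  -- key estimate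
  have key : ∀ p q : ℝ, 0 ≤ p → 0 ≤ q → ‖T p z - T q z‖ ≤ M * ‖T |p - q| z - z‖ := by
    have main : ∀ p q : ℝ, 0 ≤ p → p ≤ q → ‖T q z - T p z‖ ≤ M * ‖T (q - p) z - z‖ := by
      intro p q hp hpq
      have h1 : T q = T p ∘L T (q - p) := by
        rw [← hadd p (q - p) hp (by linarith)]; congr 1; ring
      have h2 : T q z - T p z = T p (T (q - p) z - z) := by
        rw [h1]; simp
      rw [h2]
      exact ((T p).le_opNorm _).trans (mul_le_mul_of_nonneg_right (hM p hp) (norm_nonneg _))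
    intro p q hp hq
    rcases le_total p q with h | h
    · rw [norm_sub_rev, abs_sub_comm, abs_of_nonneg (sub_nonneg.2 h)]
      exact main p q hp h
    · rw [abs_of_nonneg (sub_nonneg.2 h)]
      exact main q p hq h
  rw [continuous_iff_continuousAt]
  intro s
  rw [ContinuousAt, tendsto_iff_norm_sub_tendsto_zero]
  have hl : Tendsto (fun r : ℝ => |max r 0 - max s 0|) (𝓝 s) (𝓝[≥] (0 : ℝ)) := by
    apply tendsto_nhdsWithin_of_tendsto_nhds_of_eventually_within
    · have : Continuous (fun r : ℝ => |max r 0 - max s 0|) := by fun_prop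
      simpa using this.tendsto s
    · exact Eventually.of_forall fun r => Set.mem_Ici.2 (abs_nonneg _)
  have h3 : Tendsto (fun r : ℝ => M * ‖T |max r 0 - max s 0| z - z‖) (𝓝 s) (𝓝 0) := by
    have := ((tendsto_iff_norm_sub_tendsto_zero.1 (hlim z)).comp hl).const_mul M
    simpa using this
  exact squeeze_zero (fun _ => norm_nonneg _)
    (fun r => key _ _ (le_max_right _ _) (le_max_right _ _)) h3

lemma aux_gen {X : Type*} [NormedAddCommGroup X] [NormedSpace ℂ X] [CompleteSpace X]
    (T : ℝ → X →L[ℂ] X) (M : ℝ) (hT : IsC0Semigroup T) (hM : ∀ t, 0 ≤ t → ‖T t‖ ≤ M) (z : X)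
    (h : ℝ) (hh : 0 ≤ h) :
    InGenDomain T (∫ s in (0:ℝ)..h, T (max s 0) z) (T h z - z) := by
  have hc := aux_cont T M hT hM z
  obtain ⟨h0, hadd, hlim⟩ := hT
  set τ : ℝ → X := fun s => T (max s 0) z with hτ
  have hd : ∀ r, HasDerivAt (fun r => ∫ s in (0:ℝ)..r, τ s) (τ r) r := fun r =>
    intervalIntegral.integral_hasDerivAt_right (hc.intervalIntegrable _ _)
      (hc.stronglyMeasurableAtFilter _ _) hc.continuousAt
  have e1 := (hd h).tendsto_slope_zero_right
  have e2 := (hd 0).tendsto_slope_zero_right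
  have e3 := e1.sub e2
  have v1 : τ h = T h z := by simp [hτ, hh]
  have v2 : τ 0 = z := by simp [hτ, h0]
  rw [v1, v2] at e3
  unfold InGenDomain
  refine e3.congr' ?_
  filter_upwards [self_mem_nhdsWithin] with t ht
  have ht : 0 < t := ht
  have h4 : T t (∫ s in (0:ℝ)..h, τ s) = ∫ s in t..(t + h), τ s := by
    rw [← ContinuousLinearMap.intervalIntegral_comp_comm _ (hc.intervalIntegrable _ _)]
    have : ∫ s in (0:ℝ)..h, T t (τ s) = ∫ s in (0:ℝ)..h, τ (t + s) := by
      apply intervalIntegral.integral_congr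
      intro s hs
      rw [Set.uIcc_of_le hh] at hs
      simp only [hτ]
      rw [max_eq_left hs.1, max_eq_left (by linarith [hs.1]), hadd t s ht.le hs.1]
      rfl
    rw [this, intervalIntegral.integral_comp_add_left (fun s => τ s) t]
    simp
  rw [h4]
  have ii : ∀ a b, IntervalIntegrable τ volume a b := fun a b => hc.intervalIntegrable _ _
  have h5 : ∫ s in t..(t + h), τ s = (∫ s in (0:ℝ)..(t+h), τ s) - ∫ s in (0:ℝ)..t, τ s :=
    (intervalIntegral.integral_interval_sub_left (ii _ _) (ii _ _)).symm
  rw [h5, ← smul_sub]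
  simp only [zero_add, intervalIntegral.integral_same, sub_zero, add_comm h t]
  congr 1
  abel

lemma aux_exp {X : Type*} [NormedAddCommGroup X] [NormedSpace ℂ X] [CompleteSpace X]
    (T : ℝ → X →L[ℂ] X) (M : ℝ) (hT : IsC0Semigroup T) (hM : ∀ t, 0 ≤ t → ‖T t‖ ≤ M)
    (f : X →L[ℂ] ℂ) (l : ℂ) (hf : ∀ z y : X, InGenDomain T z y → f y = l * f z)
    (z : X) (h : ℝ) (hh : 0 ≤ h) : f (T h z) = Complex.exp (l * h) * f z := by
  have hc := aux_cont T M hT hM z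
  set τ : ℝ → X := fun s => T (max s 0) z with hτ
  have hcf : Continuous (fun s => f (τ s)) := f.continuous.comp hc
  have hd : ∀ r, HasDerivAt (fun r => ∫ s in (0:ℝ)..r, f (τ s)) (f (τ r)) r := fun r =>
    intervalIntegral.integral_hasDerivAt_right (hcf.intervalIntegrable _ _)
      (hcf.stronglyMeasurableAtFilter _ _) hcf.continuousAt
  have hP : ∀ r, 0 ≤ r → f (T r z) = f z + l * ∫ s in (0:ℝ)..r, f (τ s) := by
    intro r hr
    have := hf _ _ (aux_gen T M hT hM z r hr)
    rw [map_sub, ← ContinuousLinearMap.intervalIntegral_comp_comm _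
      (hc.intervalIntegrable _ _)] at this
    rw [← this]; ring
  have hQ : ∀ r : ℝ, 0 ≤ r → HasDerivAt
      (fun r : ℝ => Complex.exp (-l * r) * (f z + l * ∫ s in (0:ℝ)..r, f (τ s))) 0 r := by
    intro r hr
    have a1 : HasDerivAt (fun r : ℝ => Complex.exp (-l * r)) (Complex.exp (-l * r) * (-l * 1)) r :=
      ((Complex.ofRealCLM.hasDerivAt (x := r)).const_mul (-l)).cexp
    have a2 := ((hd r).const_mul l).const_add (f z)
    have a3 := a1.mul a2
    have e0 : Complex.exp (-l * r) * (-l * 1) * (f z + l * ∫ s in (0:ℝ)..r, f (τ s)) +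
        Complex.exp (-l * r) * (l * f (τ r)) = 0 := by
      rw [← hP r hr]
      simp only [hτ, max_eq_left hr]
      ring
    rw [← e0]
    exact a3
  have := constant_of_has_deriv_right_zero (a := 0) (b := h)
    (f := fun r : ℝ => Complex.exp (-l * r) * (f z + l * ∫ s in (0:ℝ)..r, f (τ s)))
    (fun r hr => (hQ r hr.1).continuousAt.continuousWithinAt)
    (fun r hr => (hQ r hr.1).hasDerivWithinAt) h ⟨hh, le_rfl⟩
  simp only [intervalIntegral.integral_same] at this
  rw [← hP h hh] at this
  simp at this
  rw [← this, ← mul_assoc, ← Complex.exp_add]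
  simp

lemma aux_prod {X : Type*} [NormedAddCommGroup X] [NormedSpace ℂ X]
    (f : X →L[ℂ] ℂ) (x : X) : ∀ {n : ℕ} (B : Fin n → X →L[ℂ] X) (c : Fin n → ℂ)
    (_ : ∀ j z, f (B j z) = Complex.exp (c j) * f z),
    f ((List.ofFn B).prod x) = Complex.exp (∑ j, c j) * f x := by
  intro n
  induction n with
  | zero => intro B c _; simp
  | succ n ih =>
    intro B c h
    rw [List.ofFn_succ, List.prod_cons, Fin.sum_univ_succ, Complex.exp_add, mul_assoc,
      ← ih (fun j => B j.succ) (fun j => c j.succ) (fun j z => h j.succ z), ← h 0]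
    rfl

lemma aux_re {C D : ℝ} (hD : 0 < D) (a : ℝ) (h : ∀ t : ℝ, 0 ≤ t → Real.exp (a * t) * D ≤ C) :
    a ≤ 0 := by
  by_contra! ha
  have hC : 0 ≤ C := le_trans (by positivity) (h 0 le_rfl)
  have h1 := h (C / D / a) (by positivity)
  have h2 : a * (C / D / a) = C / D := by field_simp
  rw [h2] at h1
  have h3 := Real.add_one_le_exp (C / D)
  have h4 : (C / D + 1) * D = C + D := by field_simp
  nlinarith

/-- real inequality -/
lemma aux_S {S : ℝ} (hS : 0 ≤ S) : S ≤ (1 + S) * (1 - Real.exp (-S)) := by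
  have h1 := Real.add_one_le_exp S
  have h2 : Real.exp (-S) * Real.exp S = 1 := by rw [← Real.exp_add]; simp
  have h3 := Real.exp_pos (-S)
  nlinarith

lemma aux_norm {n : ℕ} (l : Fin n → ℂ) (u : Fin n → ℝ) (hu : ∀ j, 0 ≤ u j) {K : ℝ}
    (hK : ∀ j, ‖l j‖ ≤ K) : ‖∑ j, l j * (u j : ℂ)‖ ≤ K * ∑ j, u j := by
  rw [Finset.mul_sum]
  refine (norm_sum_le _ _).trans (Finset.sum_le_sum fun j _ => ?_)
  rw [norm_mul, Complex.norm_real, Real.norm_of_nonneg (hu j)]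
  exact mul_le_mul_of_nonneg_right (hK j) (hu j)

lemma aux_re_sum {n : ℕ} (l : Fin n → ℂ) (u : Fin n → ℝ) :
    (∑ j, l j * (u j : ℂ)).re = ∑ j, (l j).re * u j := by
  simp [Complex.re_sum]

lemma aux_expsub {z : ℂ} (hz : z.re ≤ 0) : ‖Complex.exp z - 1‖ ≤ ‖z‖ := by
  have := (convex_halfSpace_re_le 0).norm_image_sub_le_of_norm_hasDerivWithin_le
    (f := Complex.exp) (f' := Complex.exp) (C := 1) (x := 0) (y := z)
    (fun w _ => (Complex.hasDerivAt_exp w).hasDerivWithinAt)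
    (fun w hw => by
      rw [Complex.norm_exp]; exact Real.exp_le_one_iff.2 hw) (by simp) hz
  simpa using this

lemma aux_bound {n : ℕ} (l : Fin n → ℂ) (hl : ∀ j, (l j).re ≤ 0) (u : Fin n → ℝ)
    (hu : ∀ j, 0 ≤ u j) {K : ℝ} (hK0 : 0 ≤ K) (hK : ∀ j, ‖l j‖ ≤ K) :
    ‖Complex.exp (∑ j, l j * (u j : ℂ)) - 1‖ ≤ (K + 2) * (1 - Real.exp (-∑ j, u j)) := by
  set S := ∑ j, u j with hSdef
  have hS : 0 ≤ S := Finset.sum_nonneg fun j _ => hu j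
  have hre : (∑ j, l j * (u j : ℂ)).re ≤ 0 := by
    rw [aux_re_sum]
    exact Finset.sum_nonpos fun j _ => mul_nonpos_of_nonpos_of_nonneg (hl j) (hu j)
  have h1 : ‖Complex.exp (∑ j, l j * (u j : ℂ)) - 1‖ ≤ K * S :=
    (aux_expsub hre).trans (aux_norm l u hu hK)
  have h2 : ‖Complex.exp (∑ j, l j * (u j : ℂ)) - 1‖ ≤ 2 := by
    refine (norm_sub_le _ _).trans ?_
    have : ‖Complex.exp (∑ j, l j * (u j : ℂ))‖ ≤ 1 := by
      rw [Complex.norm_exp]; exact Real.exp_le_one_iff.2 hre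
    norm_num; linarith
  have h3 := aux_S hS
  set N := ‖Complex.exp (∑ j, l j * (u j : ℂ)) - 1‖
  have h4 : (1 + S) * N ≤ (1 + S) * ((K + 2) * (1 - Real.exp (-S))) := by
    have : (1 + S) * N ≤ (K + 2) * S := by nlinarith
    have : (K + 2) * S ≤ (K + 2) * ((1 + S) * (1 - Real.exp (-S))) :=
      mul_le_mul_of_nonneg_left h3 (by linarith)
    nlinarith
  exact le_of_mul_le_mul_left h4 (by linarith)

/-- `∫ (e^{l·u} - 1) dρ` -/
noncomputable def Phi {n : ℕ} (ρ : Measure (Fin n → ℝ)) (l : Fin n → ℂ) : ℂ :=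
  ∫ u, (Complex.exp (∑ j, l j * (u j : ℂ)) - 1) ∂ρ

lemma aux_meas {n : ℕ} (l : Fin n → ℂ) :
    Continuous (fun u : Fin n → ℝ => Complex.exp (∑ j, l j * (u j : ℂ)) - 1) := by
  fun_prop

lemma aux_K {n : ℕ} (l : Fin n → ℂ) (j : Fin n) : ‖l j‖ ≤ ∑ i, ‖l i‖ :=
  Finset.single_le_sum (f := fun i => ‖l i‖) (fun _ _ => norm_nonneg _) (Finset.mem_univ j)

lemma aux_int {n : ℕ} {ρ : Measure (Fin n → ℝ)} (h0 : ∀ᵐ u ∂ρ, ∀ j, 0 ≤ u j)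
    (hi : Integrable (fun u : Fin n → ℝ => 1 - Real.exp (-∑ j, u j)) ρ)
    (l : Fin n → ℂ) (hl : ∀ j, (l j).re ≤ 0) :
    Integrable (fun u : Fin n → ℝ => Complex.exp (∑ j, l j * (u j : ℂ)) - 1) ρ := by
  refine (hi.const_mul ((∑ i, ‖l i‖) + 2)).mono' (aux_meas l).aestronglyMeasurable ?_
  filter_upwards [h0] with u hu
  exact aux_bound l hl u hu (Finset.sum_nonneg fun _ _ => norm_nonneg _) (aux_K l)

lemma aux_lim {n : ℕ} {ρ : Measure (Fin n → ℝ)} (h0 : ∀ᵐ u ∂ρ, ∀ j, 0 ≤ u j)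
    (hi : Integrable (fun u : Fin n → ℝ => 1 - Real.exp (-∑ j, u j)) ρ)
    (l : Fin n → ℂ) (hl : ∀ j, (l j).re ≤ 0) :
    Tendsto (fun ε : ℝ => Phi ρ (fun j => l j - ε)) (𝓝[>] 0) (𝓝 (Phi ρ l)) := by
  unfold Phi
  have hsm : ∀ᶠ ε : ℝ in 𝓝[>] 0, 0 < ε ∧ ε < 1 := by
    have := Ioo_mem_nhdsGT (zero_lt_one (α := ℝ))
    exact this
  apply tendsto_integral_filter_of_dominated_convergence
    (fun u => ((∑ i, ‖l i‖) + 1 + 2) * (1 - Real.exp (-∑ j, u j)))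
  · exact Eventually.of_forall fun ε => (aux_meas _).aestronglyMeasurable
  · filter_upwards [hsm] with ε hε
    filter_upwards [h0] with u hu
    refine aux_bound _ (fun j => ?_) u hu
      (add_nonneg (Finset.sum_nonneg fun _ _ => norm_nonneg _) zero_le_one) (fun j => ?_)
    · simp; linarith [hl j]
    · refine (norm_sub_le _ _).trans (add_le_add (aux_K l j) ?_)
      rw [Complex.norm_real, Real.norm_of_nonneg hε.1.le]; exact hε.2.le
  · exact hi.const_mul _
  · refine Eventually.of_forall fun u => ?_
    have : Continuous (fun ε : ℝ => Complex.exp (∑ j, (l j - ε) * (u j : ℂ)) - 1) := by fun_prop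
    have := this.tendsto 0
    simp only [Complex.ofReal_zero, sub_zero] at this
    exact this.mono_left nhdsWithin_le_nhds

lemma aux_diff {n : ℕ} {ρ : Measure (Fin n → ℝ)} (h0 : ∀ᵐ u ∂ρ, ∀ j, 0 ≤ u j)
    (hi : Integrable (fun u : Fin n → ℝ => 1 - Real.exp (-∑ j, u j)) ρ)
    (a b : Fin n → ℝ) (w₀ : ℂ) (hw : ∀ j, a j + w₀.re * b j < 0) :
    DifferentiableAt ℂ (fun w : ℂ => Phi ρ (fun j => a j + w * b j)) w₀ := by
  have hev : ∀ᶠ p : ℝ × ℂ in 𝓝 (0, w₀), ∀ j, a j + p.2.re * b j < -p.1 := by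
    rw [eventually_all]
    intro j
    have c1 : Continuous (fun p : ℝ × ℂ => a j + p.2.re * b j) := by fun_prop
    have c2 : Continuous (fun p : ℝ × ℂ => -p.1) := by fun_prop
    exact (c1.tendsto (0, w₀)).eventually_lt (c2.tendsto (0, w₀)) (by simpa using hw j)
  obtain ⟨δ, hδ, hball⟩ := Metric.eventually_nhds_iff_ball.1 hev
  have hε : ∀ w ∈ Metric.ball w₀ δ, ∀ j, a j + w.re * b j < -(δ / 2) := by
    intro w hw
    have : ((δ / 2, w) : ℝ × ℂ) ∈ Metric.ball (0, w₀) δ := by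
      rw [← ball_prod_same]
      refine ⟨?_, hw⟩
      rw [Metric.mem_ball, dist_zero_right, Real.norm_of_nonneg (by positivity)]
      linarith
    exact hball _ this
  set ε := δ / 2 with hεdef
  have hεp : 0 < ε := by positivity
  set B := ∑ i, ‖(b i : ℂ)‖ with hB
  have hB0 : 0 ≤ B := Finset.sum_nonneg fun _ _ => norm_nonneg _
  unfold Phi
  refine (hasDerivAt_integral_of_dominated_loc_of_deriv_le (𝕜 := ℂ) (μ := ρ)
    (F := fun (w : ℂ) (u : Fin n → ℝ) => Complex.exp (∑ j, (a j + w * b j) * (u j : ℂ)) - 1)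
    (F' := fun (w : ℂ) (u : Fin n → ℝ) =>
      Complex.exp (∑ j, (a j + w * b j) * (u j : ℂ)) * ∑ j, (b j : ℂ) * (u j : ℂ))
    (x₀ := w₀) (s := Metric.ball w₀ δ)
    (bound := fun u => (B * (1 + ε⁻¹)) * (1 - Real.exp (-∑ j, u j)))
    (Metric.ball_mem_nhds _ hδ) ?_ ?_ ?_ ?_ ?_ ?_).2.differentiableAt
  · exact Eventually.of_forall fun w => (aux_meas _).aestronglyMeasurable
  · exact aux_int h0 hi _ (fun j => by simpa using (hw j).le)
  · apply Continuous.aestronglyMeasurable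
    fun_prop
  · filter_upwards [h0] with u hu w hwb
    set S := ∑ j, u j with hSdef
    have hS : 0 ≤ S := Finset.sum_nonneg fun j _ => hu j
    have n1 : ‖Complex.exp (∑ j, (a j + w * b j) * (u j : ℂ))‖ ≤ Real.exp (-(ε * S)) := by
      rw [Complex.norm_exp, aux_re_sum]
      apply Real.exp_le_exp.2
      rw [hSdef, Finset.mul_sum, ← Finset.sum_neg_distrib]
      refine Finset.sum_le_sum fun j _ => ?_
      have := (hε w hwb j).le
      have e : ((a j : ℂ) + w * b j).re = a j + w.re * b j := by simp
      rw [e]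
      nlinarith [hu j]
    have n2 : ‖∑ j, (b j : ℂ) * (u j : ℂ)‖ ≤ B * S :=
      aux_norm _ u hu (aux_K (fun j => (b j : ℂ)))
    rw [norm_mul]
    have h3 := aux_S hS
    have h4 : Real.exp (-(ε * S)) * (1 + S) ≤ 1 + ε⁻¹ := by
      have e1 : Real.exp (-(ε * S)) ≤ 1 := Real.exp_le_one_iff.2 (by nlinarith)
      have e2 : Real.exp (-(ε * S)) * (ε * S) ≤ 1 := by
        have q1 := Real.add_one_le_exp (ε * S)
        have q2 : Real.exp (-(ε * S)) * Real.exp (ε * S) = 1 := by rw [← Real.exp_add]; simp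
        have q3 := Real.exp_pos (-(ε * S))
        nlinarith
      have e3 : Real.exp (-(ε * S)) * S ≤ ε⁻¹ := by
        rw [← mul_one (ε⁻¹), le_inv_mul_iff₀ hεp]
        linarith
      linarith
    have h5 : 0 ≤ 1 - Real.exp (-S) := sub_nonneg.2 (Real.exp_le_one_iff.2 (by linarith))
    calc _ ≤ Real.exp (-(ε * S)) * (B * S) :=
          mul_le_mul n1 n2 (norm_nonneg _) (Real.exp_pos _).le
      _ ≤ Real.exp (-(ε * S)) * (B * ((1 + S) * (1 - Real.exp (-S)))) := by gcongr
      _ = B * (Real.exp (-(ε * S)) * (1 + S)) * (1 - Real.exp (-S)) := by ring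
      _ ≤ _ := by gcongr
  · exact hi.const_mul _
  · refine Eventually.of_forall fun u w _ => ?_
    have : HasDerivAt (fun w : ℂ => ∑ j, (a j + w * b j) * (u j : ℂ))
        (∑ j, (b j : ℂ) * (u j : ℂ)) w := by
      apply HasDerivAt.fun_sum
      intro j _
      have := ((((hasDerivAt_id w).mul_const (b j : ℂ)).const_add (a j : ℂ)).mul_const (u j : ℂ))
      simpa using this
    exact this.cexp.sub_const 1

lemma aux_laplace {n : ℕ} {ψ : (Fin n → ℝ) → ℝ} {c₀ : ℝ} {c₁ : Fin n → ℝ}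
    {μ ν : Measure (Fin n → ℝ)} (hrep : HasLevyRep n ψ c₀ c₁ μ) (t : ℝ) [IsFiniteMeasure ν]
    (hν0 : ν {u | ¬ ∀ j, 0 ≤ u j} = 0)
    (hν : ∀ s ∈ negOrthant n, ∫ u, Real.exp (∑ j, s j * u j) ∂ν = Real.exp (t * ψ s))
    (l : Fin n → ℂ) (hl : ∀ j, (l j).re ≤ 0) :
    ∫ u, Complex.exp (∑ j, l j * (u j : ℂ)) ∂ν = Complex.exp (t * psiC n c₀ c₁ μ l) := by
  obtain ⟨-, -, hμ0, hint, hψ⟩ := hrep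
  have m0 : ∀ᵐ u ∂μ, ∀ j, 0 ≤ u j := by
    have : ∀ᵐ u ∂μ, (∀ j, 0 ≤ u j) ∧ u ≠ 0 := hμ0
    exact this.mono fun u h => h.1
  have n0 : ∀ᵐ u ∂ν, ∀ j, 0 ≤ u j := hν0
  have mi : Integrable (fun u : Fin n → ℝ => 1 - Real.exp (-∑ j, u j)) μ := by
    have := (hint (fun _ => -1) (fun j => by norm_num)).neg
    refine this.congr (Eventually.of_forall fun u => ?_)
    simp
  have ni : Integrable (fun u : Fin n → ℝ => 1 - Real.exp (-∑ j, u j)) ν := by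
    refine (integrable_const (1:ℝ)).mono'
      (Continuous.aestronglyMeasurable (by fun_prop)) ?_
    filter_upwards [n0] with u hu
    have hS : 0 ≤ ∑ j, u j := Finset.sum_nonneg fun j _ => hu j
    have h5 : 0 ≤ 1 - Real.exp (-∑ j, u j) :=
      sub_nonneg.2 (Real.exp_le_one_iff.2 (by linarith))
    rw [Real.norm_of_nonneg h5]
    linarith [Real.exp_pos (-∑ j, u j)]
  have hL : ∀ l : Fin n → ℂ, (∀ j, (l j).re ≤ 0) →
      ∫ u, Complex.exp (∑ j, l j * (u j : ℂ)) ∂ν = Phi ν l + ν.real Set.univ := by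
    intro l hl
    have := integral_add (aux_int n0 ni l hl) (integrable_const (1:ℂ) (μ := ν))
    simpa [Phi] using this
  have hR : ∀ l, psiC n c₀ c₁ μ l = c₀ + ∑ j, (c₁ j : ℂ) * l j + Phi μ l := fun l => rfl
  -- real points
  have hreal : ∀ s ∈ negOrthant n, Phi ν (fun j => (s j : ℂ)) + ν.real Set.univ =
      Complex.exp (t * (c₀ + ∑ j, (c₁ j : ℂ) * (s j : ℂ) + Phi μ (fun j => (s j : ℂ)))) := by
    intro s hs
    rw [← hL _ (fun j => by simpa using (hs j).le)]
    have e1 := congrArg (fun r : ℝ => (r : ℂ)) (hν s hs)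
    simp only [← integral_complex_ofReal] at e1
    rw [hψ s hs] at e1
    push_cast [← integral_complex_ofReal] at e1
    exact e1
  -- open half space
  have hopen : ∀ l : Fin n → ℂ, (∀ j, (l j).re < 0) → Phi ν l + ν.real Set.univ =
      Complex.exp (t * (c₀ + ∑ j, (c₁ j : ℂ) * l j + Phi μ l)) := by
    intro l hl
    set a : Fin n → ℝ := fun j => (l j).re with ha
    set b : Fin n → ℝ := fun j => (l j).im with hb
    set U : Set ℂ := {w | ∀ j, a j + w.re * b j < 0} with hU
    have hUo : IsOpen U := by
      have : U = ⋂ j, {w : ℂ | a j + w.re * b j < 0} := by ext; simp [hU]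
      rw [this]
      refine isOpen_iInter_of_finite fun j => isOpen_lt (by fun_prop) (by fun_prop)
    have hUc : Convex ℝ U := by
      intro w hw v hv p q hp hq hpq j
      have h1 := hw j
      have h2 := hv j
      have e : a j + (p • w + q • v).re * b j
          = p * (a j + w.re * b j) + q * (a j + v.re * b j) := by
        simp only [Complex.add_re, Complex.real_smul, Complex.re_ofReal_mul]
        linear_combination (-(a j)) * hpq
      rw [e]
      rcases hp.eq_or_lt with h | h
      · have : q = 1 := by linarith
        rw [← h, this]; linarith
      · have := mul_neg_of_pos_of_neg h h1
        have := mul_nonpos_of_nonneg_of_nonpos hq h2.le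
        linarith
    have h0U : (0:ℂ) ∈ U := fun j => by simpa using hl j
    have hIU : Complex.I ∈ U := fun j => by simpa using hl j
    have d1 : DifferentiableOn ℂ (fun w : ℂ => Phi ν (fun j => a j + w * b j) + ν.real Set.univ) U :=
      fun w hw => ((aux_diff n0 ni a b w hw).add_const _).differentiableWithinAt
    have d2 : DifferentiableOn ℂ (fun w : ℂ => Complex.exp (t * (c₀ +
        ∑ j, (c₁ j : ℂ) * (a j + w * b j) + Phi μ (fun j => a j + w * b j)))) U := by
      intro w hw
      have := aux_diff m0 mi a b w hw
      have h1 : DifferentiableAt ℂ (fun w : ℂ => (c₀ : ℂ) +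
        ∑ j, (c₁ j : ℂ) * (a j + w * b j)) w := by fun_prop
      exact ((h1.add this).const_mul (t : ℂ)).cexp.differentiableWithinAt
    have hfr : ∃ᶠ w in 𝓝[≠] (0:ℂ), (fun w : ℂ => Phi ν (fun j => a j + w * b j) + ν.real Set.univ) w
        = (fun w : ℂ => Complex.exp (t * (c₀ +
        ∑ j, (c₁ j : ℂ) * (a j + w * b j) + Phi μ (fun j => a j + w * b j)))) w := by
      have ht : Tendsto (fun r : ℝ => (r : ℂ)) (𝓝[≠] 0) (𝓝[≠] (0:ℂ)) := by
        apply tendsto_nhdsWithin_of_tendsto_nhds_of_eventually_within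
        · exact (Complex.continuous_ofReal.tendsto' 0 0 (by simp)).mono_left nhdsWithin_le_nhds
        · filter_upwards [self_mem_nhdsWithin] with r hr
          simpa using hr
      refine ht.frequently (Eventually.frequently ?_)
      have hUr : ∀ᶠ r : ℝ in 𝓝[≠] 0, (r : ℂ) ∈ U := by
        have := (Complex.continuous_ofReal.tendsto' 0 0 (by simp)).eventually (hUo.mem_nhds h0U)
        exact this.filter_mono nhdsWithin_le_nhds
      filter_upwards [hUr] with r hr
      have := hreal (fun j => a j + r * b j) (fun j => by simpa using hr j)
      push_cast at this
      exact this
    have := (d1.analyticOnNhd hUo).eqOn_of_preconnected_of_frequently_eq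
      (d2.analyticOnNhd hUo) hUc.isPreconnected h0U hfr hIU
    have hli : ∀ j, (a j : ℂ) + Complex.I * b j = l j := fun j => by
      rw [mul_comm]; exact Complex.re_add_im (l j)
    simpa only [hli] using this
  rw [hL l hl, hR]
  have t1 := (aux_lim n0 ni l hl).add_const (ν.real Set.univ : ℂ)
  have t2 := aux_lim m0 mi l hl
  have t3 : Tendsto (fun ε : ℝ => (c₀ : ℂ) + ∑ j, (c₁ j : ℂ) * (l j - ε)) (𝓝[>] 0)
      (𝓝 ((c₀ : ℂ) + ∑ j, (c₁ j : ℂ) * l j)) := by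
    have : Continuous (fun ε : ℝ => (c₀ : ℂ) + ∑ j, (c₁ j : ℂ) * (l j - ε)) := by fun_prop
    have := this.tendsto 0
    simp only [Complex.ofReal_zero, sub_zero] at this
    exact this.mono_left nhdsWithin_le_nhds
  have t4 := (((t3.add t2).const_mul (t : ℂ))).cexp
  refine tendsto_nhds_unique t1 (t4.congr' ?_)
  filter_upwards [self_mem_nhdsWithin] with ε hε
  have hε : 0 < ε := hε
  exact (hopen (fun j => l j - ε) (fun j => by simp; linarith [hl j])).symm

/-- Suppose `α` is an eigenvalue of `ψ(A)` (the generator of the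
subordinated semigroup `g(A)`) with eigenvector `x`, and `f ∈ X'` is a joint
eigenvector of the adjoint tuple `A'` (i.e. `Aⱼ' f = λⱼ f`, meaning `f(Aⱼ z) = λⱼ f(z)`
for all `z ∈ D(Aⱼ)`) such that `f(x) ≠ 0`. Then `α = ψ(λ)` and `α ∈ ψ(σ_R(A))`. -/
theorem eigenvalue_eq_psi_of_adjoint_joint_eigenvector
    {X : Type*} [NormedAddCommGroup X] [NormedSpace ℂ X] [CompleteSpace X]
    {n : ℕ} (T : Fin n → ℝ → X →L[ℂ] X) (M : Fin n → ℝ)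
    (hT : ∀ j, IsC0Semigroup (T j)) (hM : ∀ j t, 0 ≤ t → ‖T j t‖ ≤ M j)
    (hcomm : ∀ i j s t, 0 ≤ s → 0 ≤ t → T i s ∘L T j t = T j t ∘L T i s)
    (ψ : (Fin n → ℝ) → ℝ) (c₀ : ℝ) (c₁ : Fin n → ℝ) (μ : MeasureTheory.Measure (Fin n → ℝ))
    (hψ : MemTn n ψ) (hrep : HasLevyRep n ψ c₀ c₁ μ)
    (ν : ℝ → MeasureTheory.Measure (Fin n → ℝ)) (hν : IsSubordinator n ψ ν)
    (g : ℝ → X →L[ℂ] X) (hgsem : IsC0Semigroup g)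
    (hg : ∀ t, 0 ≤ t → ∀ x : X, g t x = ∫ u, Tprod T u x ∂(ν t))
    (x : X) (hx : x ≠ 0) (α : ℂ) (hαx : InGenDomain g x (α • x))
    (f : X →L[ℂ] ℂ) (l : Fin n → ℂ)
    (hf : ∀ j, ∀ z y : X, InGenDomain (T j) z y → f y = l j * f z)
    (hfx : f x ≠ 0) :
    α = psiC n c₀ c₁ μ l ∧ α ∈ psiC n c₀ c₁ μ '' JointResidualSpectrum T := by
  have hexp : ∀ j, ∀ t, 0 ≤ t → ∀ z, f (T j t z) = Complex.exp (l j * t) * f z :=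
    fun j t ht z => aux_exp (T j) (M j) (hT j) (hM j) f (l j) (hf j) z t ht
  have hl : ∀ j, (l j).re ≤ 0 := by
    intro j
    refine aux_re (C := ‖f‖ * (M j * ‖x‖)) (norm_pos_iff.2 hfx) _ (fun t ht => ?_)
    have h1 : ‖f (T j t x)‖ = Real.exp ((l j).re * t) * ‖f x‖ := by
      rw [hexp j t ht x, norm_mul, Complex.norm_exp]; simp
    rw [← h1]
    refine (f.le_opNorm _).trans (mul_le_mul_of_nonneg_left ?_ (norm_nonneg _))
    exact ((T j t).le_opNorm _).trans (mul_le_mul_of_nonneg_right (hM j t ht) (norm_nonneg _))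
  have hfg : ∀ᶠ t in 𝓝[>] (0:ℝ), f (g t x) = Complex.exp (t * psiC n c₀ c₁ μ l) * f x := by
    have hne : ∀ᶠ t in 𝓝[>] (0:ℝ), g t x ≠ 0 :=
      ((hgsem.2.2 x).mono_left (nhdsWithin_mono _ Set.Ioi_subset_Ici_self)).eventually_ne hx
    filter_upwards [hne, self_mem_nhdsWithin] with t hgt ht
    have ht : 0 < t := ht
    obtain ⟨hfin, hsup, hlap⟩ := hν t ht.le
    rw [hg t ht.le x] at hgt ⊢
    have hI : Integrable (fun u => Tprod T u x) (ν t) := by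
      by_contra h
      exact hgt (integral_undef h)
    rw [← ContinuousLinearMap.integral_comp_comm f hI,
      ← aux_laplace hrep t hsup hlap l hl, ← integral_mul_const]
    apply integral_congr_ae
    have n0 : ∀ᵐ u ∂(ν t), ∀ j, 0 ≤ u j := hsup
    filter_upwards [n0] with u hu
    exact aux_prod f x (fun j => T j (u j)) (fun j => l j * u j) (fun j z => hexp j _ (hu j) z)
  have hα : α = psiC n c₀ c₁ μ l := by
    have h1 : Tendsto (fun t : ℝ => t⁻¹ • (f (g t x) - f x)) (𝓝[>] 0) (𝓝 (α * f x)) := by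
      have := (f.continuous.tendsto _).comp hαx
      simp only [map_smul, smul_eq_mul] at this
      refine this.congr fun t => ?_
      simp only [Function.comp]
      rw [← Complex.coe_smul, map_smul, map_sub, Complex.coe_smul]
    have h2 : HasDerivAt (fun t : ℝ => Complex.exp (t * psiC n c₀ c₁ μ l) * f x)
        (psiC n c₀ c₁ μ l * f x) 0 := by
      have := (((Complex.ofRealCLM.hasDerivAt (x := (0:ℝ))).mul_const
        (psiC n c₀ c₁ μ l)).cexp).mul_const (f x)
      simpa using this
    have h3 := h2.tendsto_slope_zero_right
    have h4 := tendsto_nhds_unique h1 (h3.congr' (by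
      filter_upwards [hfg] with t ht
      rw [ht]; simp))
    exact mul_right_cancel₀ hfx h4
  refine ⟨hα, l, ?_, hα.symm⟩
  intro hd
  have hle : Submodule.span ℂ
      (⋃ j, {z : X | ∃ x y, InGenDomain (T j) x y ∧ z = l j • x - y}) ≤ f.toLinearMap.ker := by
    rw [Submodule.span_le]
    intro z hz
    obtain ⟨j, p, q, hpq, rfl⟩ := Set.mem_iUnion.1 hz
    simp [hf j p q hpq]
  have hcl : IsClosed (f.toLinearMap.ker : Set X) := f.isClosed_ker
  have hx' : x ∈ (f.toLinearMap.ker : Set X) := by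
    have := closure_minimal (show _ ⊆ (f.toLinearMap.ker : Set X) from hle) hcl
    exact this (hd x)
  exact hfx hx'
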